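/- For all integers s ≥ 50000 and q₀ with 20·s ≤ q₀ ≤ s²/(200·log s), there exists an integer q with |q − q₀| ≤ s such that Lazebnik's conjecture is false for the pair (s,q): there exist a positive integer n divisible by s and a graph G with n vertices and the same number of edges as the Turán graph T_s(n) such that P_G(q) > P_{T_s(n)}(q). -/

import Mathlib

open SimpleGraph

/-- Number of proper `q`-colorings of a graph on `Fin n`. -/
noncomputable def numColorings (q : ℕ) {n : ℕ} (G : SimpleGraph (Fin n)) : ℕ :=
  Nat.card { f : Fin n → Fin q // ∀ v w, G.Adj v w → f v ≠ f w }

/-- Number of edges of a graph on `Fin n`. -/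
noncomputable def numEdges {n : ℕ} (G : SimpleGraph (Fin n)) : ℕ :=
  Nat.card G.edgeSet

/-- Lazebnik's conjecture is false for the pair `(s, q)`: for some `n` divisible by `s`,
some graph with `n` vertices and as many edges as the Turán graph `T_s(n)` has strictly
more proper `q`-colorings than `T_s(n)`. -/
def LazebnikFalseFor (s q : ℕ) : Prop :=
  ∃ n : ℕ, 0 < n ∧ s ∣ n ∧
    ∃ G : SimpleGraph (Fin n),
      numEdges G = numEdges (turanGraph n s) ∧
      numColorings q (turanGraph n s) < numColorings q G

/-- The colorings compatible with prescribed color classes `κ` and vertex classes `π`. -/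
theorem card_compatible_maps {V Q ι : Type*} [Fintype V] [Finite Q] [Fintype ι]
    (κ : Q → ι) (π : V → ι) :
    Nat.card {f : V → Q // ∀ v, κ (f v) = π v} =
      ∏ i, Nat.card {c // κ c = i} ^ Nat.card {v // π v = i} := by
  classical
  have e : {f : V → Q // ∀ v, κ (f v) = π v} ≃ ∀ v, {c // κ c = π v} :=
    Equiv.subtypePiEquivPi (p := fun v c => κ c = π v)
  rw [Nat.card_congr e, Nat.card_pi, ← Finset.prod_fiberwise (s := Finset.univ) (g := π)]
  refine Finset.prod_congr rfl fun i _ => ?_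
  rw [Finset.prod_congr rfl (g := fun _ => Nat.card {c // κ c = i}), Finset.prod_const,
    Nat.card_eq_fintype_card (α := {v // π v = i}), Fintype.card_subtype]
  intro v hv
  rw [(Finset.mem_filter.mp hv).2]

theorem sum_card_fiber {Q ι : Type*} [Finite Q] [Fintype ι] (κ : Q → ι) :
    ∑ i, Nat.card {c // κ c = i} = Nat.card Q := by
  classical
  rw [← Nat.card_congr (Equiv.sigmaFiberEquiv κ), Nat.card_sigma]

theorem two_mul_numEdges_add {n : ℕ} {ι : Type*} [Fintype ι] (G : SimpleGraph (Fin n))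
    (π : Fin n → ι) (hG : ∀ v w, G.Adj v w ↔ π v ≠ π w) :
    2 * numEdges G + ∑ i, Nat.card {v // π v = i} ^ 2 = n ^ 2 := by
  classical
  have h1 : 2 * numEdges G = ∑ v, G.degree v := by
    rw [G.sum_degrees_eq_twice_card_edges, numEdges, Nat.card_eq_fintype_card,
      SimpleGraph.edgeFinset_card]
  have h2 : ∑ i, Nat.card {v // π v = i} ^ 2 = ∑ v, Nat.card {w // π w = π v} := by
    rw [← Finset.sum_fiberwise (s := Finset.univ) (g := π)]
    refine Finset.sum_congr rfl fun i _ => ?_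
    rw [Finset.sum_congr rfl (g := fun _ => Nat.card {c // π c = i}), Finset.sum_const,
      Nat.card_eq_fintype_card (α := {v // π v = i}), Fintype.card_subtype, smul_eq_mul, sq]
    intro v hv
    rw [(Finset.mem_filter.mp hv).2]
  rw [h1, h2, ← Finset.sum_add_distrib, Finset.sum_congr rfl (g := fun _ => n)]
  · simp [sq]
  · intro v _
    have h3 : G.degree v = (Finset.univ.filter fun w => ¬ π w = π v).card := by
      rw [← G.card_neighborFinset_eq_degree]
      congr 1
      ext w
      simp [hG, eq_comm]
    rw [h3, Nat.card_eq_fintype_card, Fintype.card_subtype, add_comm,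
      Finset.card_filter_add_card_filter_not]
    simp

theorem exists_numEdges_eq_of_le {n m : ℕ} (H : SimpleGraph (Fin n)) (h : m ≤ numEdges H) :
    ∃ G ≤ H, numEdges G = m := by
  classical
  rw [numEdges, Nat.card_eq_fintype_card, ← SimpleGraph.edgeFinset_card] at h
  obtain ⟨S, hS, rfl⟩ := Finset.exists_subset_card_eq h
  have hS' : ∀ e ∈ S, e ∈ H.edgeSet := fun e he => SimpleGraph.mem_edgeFinset.mp (hS he)
  have hE : (SimpleGraph.fromEdgeSet (S : Set (Sym2 (Fin n)))).edgeSet = S := by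
    rw [SimpleGraph.edgeSet_fromEdgeSet]
    refine sdiff_eq_left.mpr (Set.disjoint_left.mpr fun e he hd => ?_)
    exact H.not_isDiag_of_mem_edgeSet (hS' e he) hd
  refine ⟨SimpleGraph.fromEdgeSet S, ?_, ?_⟩
  · rw [← SimpleGraph.edgeSet_subset_edgeSet, hE]
    exact hS'
  · rw [numEdges, hE]
    simp

theorem numColorings_anti {q n : ℕ} {G H : SimpleGraph (Fin n)} (h : G ≤ H) :
    numColorings q H ≤ numColorings q G :=
  Nat.card_le_card_of_injective
    (fun f => ⟨f.1, fun v w hvw => f.2 v w (h hvw)⟩)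
    fun _ _ hfg => Subtype.ext (Subtype.mk.inj hfg)

theorem prod_card_pow_le_numColorings {q n : ℕ} {ι : Type*} [Fintype ι]
    (G : SimpleGraph (Fin n)) (π : Fin n → ι) (hG : ∀ v w, G.Adj v w → π v ≠ π w)
    (κ : Fin q → ι) :
    ∏ i, Nat.card {c // κ c = i} ^ Nat.card {v // π v = i} ≤ numColorings q G := by
  rw [← card_compatible_maps]
  refine Nat.card_le_card_of_injective
    (fun f => ⟨f.1, fun v w hvw hf => hG v w hvw ?_⟩)
    fun _ _ hfg => Subtype.ext (Subtype.mk.inj hfg)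
  rw [← f.2 v, ← f.2 w, hf]

/-- A complete multipartite graph has few colorings if all compatible counts are small. -/
theorem numColorings_le {q n : ℕ} {ι : Type*} [Fintype ι] [Nonempty ι]
    (G : SimpleGraph (Fin n)) (π : Fin n → ι) (hG : ∀ v w, π v ≠ π w → G.Adj v w) (M : ℕ)
    (hM : ∀ κ : Fin q → ι, ∏ i, Nat.card {c // κ c = i} ^ Nat.card {v // π v = i} ≤ M) :
    numColorings q G ≤ Fintype.card ι ^ q * M := by
  classical
  have key : ∀ f : {f : Fin n → Fin q // ∀ v w, G.Adj v w → f v ≠ f w},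
      ∃ κ : Fin q → ι, ∀ v, κ (f.1 v) = π v := by
    intro f
    refine ⟨fun c => if h : ∃ v, f.1 v = c then π h.choose else Classical.arbitrary ι, fun v => ?_⟩
    have h : ∃ w, f.1 w = f.1 v := ⟨v, rfl⟩
    change dite (∃ w, f.1 w = f.1 v) _ _ = _
    rw [dif_pos h]
    by_contra hne
    exact f.2 _ _ (hG _ _ hne) h.choose_spec
  choose K hK using key
  have hinj : Function.Injective
      (fun f => (⟨K f, f.1, hK f⟩ :
        Σ κ : Fin q → ι, {f : Fin n → Fin q // ∀ v, κ (f v) = π v})) := by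
    intro f g hfg
    have h := congrArg (fun x : Σ κ : Fin q → ι, {f : Fin n → Fin q // ∀ v, κ (f v) = π v} =>
      x.2.1) hfg
    exact Subtype.ext h
  calc numColorings q G
      ≤ Nat.card (Σ κ : Fin q → ι, {f : Fin n → Fin q // ∀ v, κ (f v) = π v}) :=
        Nat.card_le_card_of_injective _ hinj
    _ = ∑ κ : Fin q → ι, Nat.card {f : Fin n → Fin q // ∀ v, κ (f v) = π v} := Nat.card_sigma
    _ ≤ ∑ _κ : Fin q → ι, M := Finset.sum_le_sum fun κ _ => by
        rw [card_compatible_maps]; exact hM κ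
    _ = Fintype.card ι ^ q * M := by simp

theorem mul_ratio_pow_le (k : ℕ) (hk : 0 < k) (a : ℕ) :
    (a : ℝ) * (((k : ℝ) + 1) / k) ^ k ≤ k * (((k : ℝ) + 1) / k) ^ a := by
  have hk' : (0 : ℝ) < k := by exact_mod_cast hk
  set ρ : ℝ := ((k : ℝ) + 1) / k with hρ
  have hkρ : k * ρ = k + 1 := by rw [hρ]; field_simp
  have hρ0 : 0 < ρ := by positivity
  rcases le_total k a with h | h
  · induction a, h using Nat.le_induction with
    | base => exact le_rfl
    | succ a ha ih =>
      have ha' : (k : ℝ) ≤ a := by exact_mod_cast ha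
      have : (a : ℝ) + 1 ≤ a * ρ := by
        have : ρ = 1 + 1 / k := by rw [hρ]; field_simp
        rw [this, mul_add, mul_one, mul_one_div]
        have := (one_le_div hk').mpr ha'
        linarith
      calc ((a + 1 : ℕ) : ℝ) * ρ ^ k ≤ a * ρ * ρ ^ k := by push_cast; gcongr
        _ = a * ρ ^ k * ρ := by ring
        _ ≤ k * ρ ^ a * ρ := by gcongr
        _ = k * ρ ^ (a + 1) := by ring
  · induction h using Nat.decreasingInduction with
    | self => exact le_rfl
    | of_succ a ha ih =>
      have ha' : (a : ℝ) ≤ k := by exact_mod_cast ha.le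
      have : (a : ℝ) * ρ ≤ a + 1 := by
        have : ρ = 1 + 1 / k := by rw [hρ]; field_simp
        rw [this, mul_add, mul_one, mul_one_div]
        have := (div_le_one hk').mpr ha'
        linarith
      refine le_of_mul_le_mul_right ?_ hρ0
      calc (a : ℝ) * ρ ^ k * ρ = a * ρ * ρ ^ k := by ring
        _ ≤ ((a + 1 : ℕ) : ℝ) * ρ ^ k := by push_cast; gcongr
        _ ≤ k * ρ ^ (a + 1) := ih
        _ = k * ρ ^ a * ρ := by ring

/-- A product of naturals with fixed sum is largest when the factors are balanced. -/
theorem prod_le_balanced {ι : Type*} [Fintype ι] (k r : ℕ) (hk : 0 < k)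
    (hr : r ≤ Fintype.card ι) (a : ι → ℕ) (ha : ∑ i, a i = k * Fintype.card ι + r) :
    ∏ i, a i ≤ k ^ (Fintype.card ι - r) * (k + 1) ^ r := by
  have hk' : (0 : ℝ) < k := by exact_mod_cast hk
  set ρ : ℝ := ((k : ℝ) + 1) / k with hρ
  have hkρ : k * ρ = k + 1 := by rw [hρ]; field_simp
  have hρ0 : 0 < ρ := by positivity
  have h : ∏ i, ((a i : ℝ) * ρ ^ k) ≤ ∏ i, (k * ρ ^ a i) :=
    Finset.prod_le_prod (fun i _ => by positivity) fun i _ => mul_ratio_pow_le k hk (a i)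
  simp only [Finset.prod_mul_distrib, Finset.prod_const, Finset.prod_pow_eq_pow_sum, ha,
    Finset.card_univ] at h
  rw [← pow_mul, pow_add, mul_comm, mul_left_comm] at h
  have h' := le_of_mul_le_mul_left h (by positivity)
  have e : (k : ℝ) ^ Fintype.card ι * ρ ^ r = k ^ (Fintype.card ι - r) * (k + 1) ^ r := by
    rw [← hkρ, mul_pow, ← mul_assoc, ← pow_add, Nat.sub_add_cancel hr]
  rw [e] at h'
  exact_mod_cast h'

theorem exists_fiber_card {n : ℕ} {ι : Type*} [Fintype ι] (c : ι → ℕ) (hc : ∑ i, c i = n) :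
    ∃ π : Fin n → ι, ∀ i, Nat.card {v // π v = i} = c i := by
  have e : Fin n ≃ Σ i, Fin (c i) := Fintype.equivOfCardEq (by simp [hc])
  refine ⟨fun v => (e v).1, fun i => ?_⟩
  rw [Nat.card_congr (e.subtypeEquiv (q := fun x => x.1 = i) fun _ => Iff.rfl),
    Nat.card_congr (Equiv.sigmaSubtype i), Nat.card_fin]

theorem card_fiber_modNat (m s : ℕ) (i : Fin s) :
    Nat.card {v : Fin (m * s) // v.modNat = i} = m := by
  have e := (finProdFinEquiv (m := m) (n := s)).symm.subtypeEquiv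
    (p := fun v => v.modNat = i) (q := fun x => x.2 = i) fun _ => Iff.rfl
  have e' : {x : Fin m × Fin s // x.2 = i} ≃ Fin m :=
    ⟨fun x => x.1.1, fun y => ⟨(y, i), rfl⟩, fun x => Subtype.ext (Prod.ext rfl x.2.symm),
      fun _ => rfl⟩
  rw [Nat.card_congr (e.trans e'), Nat.card_fin]

theorem turanGraph_adj_iff_modNat {m s : ℕ} (v w : Fin (m * s)) :
    (turanGraph (m * s) s).Adj v w ↔ v.modNat ≠ w.modNat := by
  simp [turanGraph, Fin.ext_iff, Fin.modNat]

theorem numColorings_turanGraph_le (m s k r : ℕ) (hs : 0 < s) (hk : 0 < k) (hr : r ≤ s) :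
    numColorings (k * s + r) (turanGraph (m * s) s) ≤
      s ^ (k * s + r) * (k ^ (s - r) * (k + 1) ^ r) ^ m := by
  have : Nonempty (Fin s) := ⟨⟨0, hs⟩⟩
  have h := numColorings_le (q := k * s + r) (turanGraph (m * s) s) Fin.modNat
    (fun v w => (turanGraph_adj_iff_modNat v w).mpr) ((k ^ (s - r) * (k + 1) ^ r) ^ m)
    fun κ => by
      simp only [card_fiber_modNat, Finset.prod_pow]
      gcongr
      have := prod_le_balanced k r hk (by simpa using hr) (fun i => Nat.card {c // κ c = i})
        (by rw [sum_card_fiber]; simp)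
      simpa using this
  simpa using h

theorem two_mul_numEdges_turanGraph_add (m s : ℕ) :
    2 * numEdges (turanGraph (m * s) s) + s * m ^ 2 = (m * s) ^ 2 := by
  have h := two_mul_numEdges_add (turanGraph (m * s) s) Fin.modNat turanGraph_adj_iff_modNat
  simpa only [card_fiber_modNat, Finset.sum_const, Finset.card_univ, Fintype.card_fin,
    smul_eq_mul] using h

theorem lazebnikFalseFor_of_parts {ι : Type*} [Fintype ι] (s k r m : ℕ) (hs : 0 < s)
    (hk : 0 < k) (hr : r ≤ s) (hm : 0 < m) (b c : ι → ℕ) (hb : ∑ i, b i = m * s)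
    (hc : ∑ i, c i = k * s + r) (hsq : ∑ i, b i ^ 2 ≤ s * m ^ 2)
    (hlt : s ^ (k * s + r) * (k ^ (s - r) * (k + 1) ^ r) ^ m < ∏ i, c i ^ b i) :
    LazebnikFalseFor s (k * s + r) := by
  obtain ⟨π, hπ⟩ := exists_fiber_card b hb
  obtain ⟨κ, hκ⟩ := exists_fiber_card c hc
  let H : SimpleGraph (Fin (m * s)) := (⊤ : SimpleGraph ι).comap π
  have hH : ∀ v w, H.Adj v w ↔ π v ≠ π w := fun v w => by simp [H]
  have hHe := two_mul_numEdges_add H π hH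
  have hTe := two_mul_numEdges_turanGraph_add m s
  simp only [hπ] at hHe
  obtain ⟨G, hGH, hG⟩ := exists_numEdges_eq_of_le (m := numEdges (turanGraph (m * s) s)) H
    (by omega)
  refine ⟨m * s, Nat.mul_pos hm hs, Dvd.intro_left m rfl, G, hG, ?_⟩
  calc numColorings (k * s + r) (turanGraph (m * s) s)
      ≤ _ := numColorings_turanGraph_le m s k r hs hk hr
    _ < _ := hlt
    _ = ∏ i, Nat.card {c // κ c = i} ^ Nat.card {v // π v = i} := by simp only [hπ, hκ]
    _ ≤ numColorings (k * s + r) H :=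
        prod_card_pow_le_numColorings H π (fun v w => (hH v w).mp) κ
    _ ≤ _ := numColorings_anti hGH

theorem exists_mul_pow_lt_pow (C X Y : ℕ) (hX : 0 < X) (h : X < Y) :
    ∃ u, 0 < u ∧ C * X ^ u < Y ^ u := by
  have hX' : (0 : ℝ) < X := by exact_mod_cast hX
  have h1 : (1 : ℝ) < Y / X := (one_lt_div hX').mpr (by exact_mod_cast h)
  obtain ⟨u, hu⟩ := pow_unbounded_of_one_lt (C : ℝ) h1
  have hu' : (C : ℝ) < (Y / X) ^ (u + 1) :=
    hu.trans (pow_lt_pow_right₀ h1 (Nat.lt_succ_self u))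
  refine ⟨u + 1, Nat.succ_pos u, ?_⟩
  rw [div_pow, lt_div_iff₀ (by positivity)] at hu'
  exact_mod_cast hu'

/-- Compared with the Turán graph, `p` parts are enlarged and get `k + 1` colors, `p` parts are
shrunk and keep `k` colors, and one small additional part gets a single color. -/
theorem lazebnikFalseFor_of_pow_lt (s k p t : ℕ) (hk : 0 < k) (hp : 5 ≤ p)
    (hs : s = 2 * p + t) (hpow : k ^ p < (k + 1) ^ (p - 5)) :
    LazebnikFalseFor s (k * s + (p + 1)) := by
  obtain ⟨d, rfl⟩ : ∃ d, p = d + 5 := ⟨p - 5, by omega⟩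
  simp only [Nat.add_sub_cancel] at hpow
  have hsub : s - (d + 5 + 1) = d + 3 + 1 + t := by omega
  have hXY : ∀ p c l : ℕ, 0 < p → 0 < l → k ^ p < l ^ d →
      (k ^ (c + 1 + t) * l ^ (p + 1)) ^ p ^ 2 <
        (l ^ (p ^ 2 + p + d)) ^ p * (k ^ (p * c)) ^ p * (k ^ p ^ 2) ^ t := by
    intro p c l hp hl h
    calc (k ^ (c + 1 + t) * l ^ (p + 1)) ^ p ^ 2
        = (k ^ (p * c * p + p ^ 2 * t) * l ^ (p ^ 2 * p + p ^ 2)) * (k ^ p) ^ p := by ring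
      _ < (k ^ (p * c * p + p ^ 2 * t) * l ^ (p ^ 2 * p + p ^ 2)) * (l ^ d) ^ p :=
        Nat.mul_lt_mul_of_pos_left (Nat.pow_lt_pow_left h hp.ne') (by positivity)
      _ = (l ^ (p ^ 2 + p + d)) ^ p * (k ^ (p * c)) ^ p * (k ^ p ^ 2) ^ t := by ring
  obtain ⟨u, hu, hlt⟩ := exists_mul_pow_lt_pow (s ^ (k * s + (d + 5 + 1))) _ _ (by positivity)
    (hXY (d + 5) (d + 3) (k + 1) (by omega) (by omega) hpow)
  refine lazebnikFalseFor_of_parts (ι := (Fin (d + 5) ⊕ Fin (d + 5)) ⊕ Fin t ⊕ Unit) s k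
    (d + 5 + 1) ((d + 5) ^ 2 * u) (by omega) hk (by omega) (by positivity)
    (Sum.elim (Sum.elim (fun _ => ((d + 5) ^ 2 + (d + 5) + d) * u)
      fun _ => (d + 5) * (d + 3) * u)
      (Sum.elim (fun _ => (d + 5) ^ 2 * u) fun _ => 5 * (d + 5) * u))
    (Sum.elim (Sum.elim (fun _ => k + 1) fun _ => k) (Sum.elim (fun _ => k) fun _ => 1))
    ?_ ?_ ?_ ?_
  · simp only [Fintype.sum_sum_type, Sum.elim_inl, Sum.elim_inr, Finset.sum_const,
      Finset.card_univ, Fintype.card_fin, Fintype.card_unit, smul_eq_mul, hs]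
    ring
  · simp only [Fintype.sum_sum_type, Sum.elim_inl, Sum.elim_inr, Finset.sum_const,
      Finset.card_univ, Fintype.card_fin, Fintype.card_unit, smul_eq_mul, hs]
    ring
  · simp only [Fintype.sum_sum_type, Sum.elim_inl, Sum.elim_inr, Finset.sum_const,
      Finset.card_univ, Fintype.card_fin, Fintype.card_unit, smul_eq_mul, hs]
    refine Nat.le.intro (k := u ^ 2 * ((d + 5) * d * (2 * d + 15))) ?_
    ring
  · simp only [Fintype.prod_sum_type, Sum.elim_inl, Sum.elim_inr, Finset.prod_const,
      Finset.card_univ, Fintype.card_fin, Fintype.card_unit, one_pow, mul_one, hsub]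
    convert hlt using 1
    · rw [pow_mul]
    · simp only [mul_pow, ← pow_mul, mul_right_comm _ u]

theorem pow_lt_succ_pow_of_log {s k p : ℕ} (hs : 50000 ≤ s) (hk : 0 < k) (hp : s ≤ 2 * p + 1)
    (h : (k : ℝ) ≤ s / (200 * Real.log s)) : k ^ p < (k + 1) ^ (p - 5) := by
  have hs' : (50000 : ℝ) ≤ s := by exact_mod_cast hs
  have hk' : (1 : ℝ) ≤ k := by exact_mod_cast hk
  have hp' : (s : ℝ) ≤ 2 * p + 1 := by exact_mod_cast hp
  have hL : 1 ≤ Real.log s := by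
    rw [Real.le_log_iff_exp_le (by linarith)]
    linarith [Real.exp_one_lt_d9]
  rw [le_div_iff₀ (by positivity)] at h
  have hks : (k : ℝ) ≤ s := by nlinarith
  have hlog : Real.log k ≤ Real.log s := Real.log_le_log (by linarith) hks
  have hinv : 1 / ((k : ℝ) + 1) ≤ Real.log (k + 1) - Real.log k := by
    rw [← Real.log_div (by positivity) (by positivity)]
    have := Real.one_sub_inv_le_log_of_pos (x := ((k : ℝ) + 1) / k) (by positivity)
    refine le_trans (le_of_eq ?_) this
    field_simp
    ring
  have hp5 : 5 ≤ p := by omega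
  have h5 : ((p - 5 : ℕ) : ℝ) = p - 5 := by push_cast [hp5]; ring
  have hp0 : (0 : ℝ) < p - 5 := by linarith
  have key : 5 * Real.log k < (p - 5) * (1 / ((k : ℝ) + 1)) := by
    rw [mul_one_div, lt_div_iff₀ (by positivity)]
    nlinarith
  have key2 := key.trans_le (mul_le_mul_of_nonneg_left hinv hp0.le)
  have : ((k : ℝ)) ^ p < ((k : ℝ) + 1) ^ (p - 5) := by
    rw [← Real.log_lt_log_iff (by positivity) (by positivity), Real.log_pow, Real.log_pow, h5]
    linarith
  exact_mod_cast this

/-- For all `s ≥ 50000` and `20 s ≤ q₀ ≤ s² / (200 log s)` there is a `q` within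
distance `s` of `q₀` for which Lazebnik's conjecture fails. -/
theorem lazebnik_counterexamples (s q₀ : ℕ) (hs : 50000 ≤ s)
    (h1 : 20 * s ≤ q₀) (h2 : (q₀ : ℝ) ≤ (s : ℝ) ^ 2 / (200 * Real.log s)) :
    ∃ q : ℕ, |(q : ℤ) - (q₀ : ℤ)| ≤ (s : ℤ) ∧ LazebnikFalseFor s q := by
  obtain ⟨a, ha⟩ : ∃ a, q₀ = a + (s / 2 + 1) := ⟨q₀ - (s / 2 + 1), by omega⟩
  have hs0 : 0 < s := by omega
  have hmod := Nat.div_add_mod a s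
  have hlt := Nat.mod_lt a hs0
  have hk : 0 < a / s := Nat.div_pos (by omega) hs0
  refine ⟨a / s * s + (s / 2 + 1), ?_, ?_⟩
  · rw [mul_comm] at hmod
    rw [abs_le]
    omega
  · refine lazebnikFalseFor_of_pow_lt s (a / s) (s / 2) (s % 2) hk (by omega) (by omega)
      (pow_lt_succ_pow_of_log hs hk (by omega) ?_)
    have hs' : (0 : ℝ) < s := by exact_mod_cast hs0
    have h3 : ((a / s : ℕ) : ℝ) * s ≤ q₀ := by
      exact_mod_cast (Nat.div_mul_le_self a s).trans (by omega)
    refine le_of_mul_le_mul_right (h3.trans (h2.trans (le_of_eq ?_))) hs'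
    ring
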